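/- Let f be defined on the open unit ball B of ℓ² by f(x) = Σ_{n=1}^∞ x_n^{2n}. Then there is no continuous convex function F : ℓ^∞ → ℝ such that F(x) = f(x) for every x ∈ B (where B ⊂ ℓ² ⊂ ℓ^∞ via the canonical inclusion). -/

import Mathlib

/-- The canonical inclusion `ℓ² ⊆ ℓ^∞`. -/
noncomputable def inclL2Linfty (x : lp (fun _ : ℕ => ℝ) 2) : lp (fun _ : ℕ => ℝ) ⊤ :=
  ⟨(x : ℕ → ℝ), (lp.memℓp x).of_exponent_ge le_top⟩

open Filter Topology

theorem inclL2Linfty_apply (x : lp (fun _ : ℕ => ℝ) 2) (k : ℕ) : inclL2Linfty x k = x k := rfl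

/-- A continuous convex function whose difference quotients at `p` in the direction of `u` are at
least `K` has the corresponding lower bound near `u`, with an error linear in the distance to `u`
and uniform in `u`. -/
theorem ConvexOn.exists_le_add_mul_norm_sub {E : Type*} [NormedAddCommGroup E] [NormedSpace ℝ E]
    {F : E → ℝ} (hF : Continuous F) (hconv : ConvexOn ℝ Set.univ F) (p : E) :
    ∃ L : ℝ, 0 ≤ L ∧ ∀ (a u : E) (K : ℝ),
      (∀ᶠ s : ℝ in 𝓝[>] 0, F p + s * K ≤ F (p + s • (u - p))) →
        F p + K ≤ F a + L * ‖a - u‖ := by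
  have hlip : LocallyLipschitz F := locallyLipschitzOn_univ.1
    ((hconv.locallyLipschitzOn_iff_continuousOn isOpen_univ).2 hF.continuousOn)
  obtain ⟨L, U, hU, hL⟩ := hlip p
  refine ⟨L, L.coe_nonneg, fun a u K hK => ?_⟩
  have hline (x : E) : ∀ᶠ s : ℝ in 𝓝[>] 0, p + s • (x - p) ∈ U := by
    have h : Tendsto (fun s : ℝ => p + s • (x - p)) (𝓝 0) (𝓝 p) := by
      have : Continuous fun s : ℝ => p + s • (x - p) := by fun_prop
      simpa using this.tendsto 0
    exact (h.mono_left nhdsWithin_le_nhds).eventually hU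
  have hlt : ∀ᶠ s : ℝ in 𝓝[>] 0, s < 1 :=
    nhdsWithin_le_nhds (Iio_mem_nhds zero_lt_one)
  obtain ⟨s, hKs, ha, hu, hs1, hs0⟩ :=
    (hK.and ((hline a).and ((hline u).and (hlt.and self_mem_nhdsWithin)))).exists
  replace hs0 : 0 < s := hs0
  have hconvex : F (p + s • (a - p)) ≤ (1 - s) * F p + s * F a := by
    have h := hconv.2 (Set.mem_univ p) (Set.mem_univ a) (sub_nonneg.2 hs1.le) hs0.le (by ring)
    rwa [smul_eq_mul, smul_eq_mul,
      show (1 - s) • p + s • a = p + s • (a - p) by module] at h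
  have hdist : F (p + s • (u - p)) - F (p + s • (a - p)) ≤ L * (s * ‖a - u‖) := by
    refine (le_abs_self _).trans ?_
    rw [← Real.dist_eq]
    refine (hL.dist_le_mul _ hu _ ha).trans_eq ?_
    rw [dist_comm, dist_eq_norm, add_sub_add_left_eq_sub, ← smul_sub, sub_sub_sub_cancel_right,
      norm_smul, Real.norm_of_nonneg hs0.le]
  refine le_of_mul_le_mul_left ?_ hs0
  linarith

/-- Bernoulli's inequality in homogeneous form on the unit interval. -/
theorem pow_add_mul_pow_mul_le_add_pow {t d : ℝ} (ht : 0 < t) (ht1 : t ≤ 1) (hd : 0 ≤ d) (N : ℕ) :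
    t ^ N + N * t ^ N * d ≤ (t + d) ^ N := by
  have h := one_add_mul_le_pow (a := d / t) (by linarith [div_nonneg hd ht.le]) N
  have hdt : d ≤ d / t := le_div_self hd ht ht1
  have htN : 0 < t ^ N := pow_pos ht N
  calc t ^ N + N * t ^ N * d = t ^ N * (1 + N * d) := by ring
    _ ≤ t ^ N * (1 + N * (d / t)) := by gcongr
    _ ≤ t ^ N * (1 + d / t) ^ N := by gcongr
    _ = (t + d) ^ N := by rw [← mul_pow]; congr 1; field_simp

theorem tsum_pow_even_single (n : ℕ) (t : ℝ) :
    ∑' k : ℕ, (lp.single (E := fun _ : ℕ => ℝ) 2 n t k) ^ (2 * (k + 1)) = t ^ (2 * (n + 1)) := by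
  rw [tsum_eq_single n]
  · simp
  · intro k hk
    rw [lp.single_apply_ne _ _ _ hk, zero_pow (by omega)]

theorem pow_even_le_tsum {y : ℕ → ℝ} {D : Finset ℕ} (hy : ∀ k ∉ D, y k = 0) (n : ℕ) :
    y n ^ (2 * (n + 1)) ≤ ∑' k : ℕ, y k ^ (2 * (k + 1)) := by
  have hs : Summable fun k : ℕ => y k ^ (2 * (k + 1)) :=
    summable_of_ne_finset_zero (s := D) fun k hk => by rw [hy k hk, zero_pow (by omega)]
  exact hs.le_tsum n fun k _ => (even_two_mul _).pow_nonneg _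

/-- The difference quotients, at a point `t • eₙ` with `t < 1`, of a function extending
`∑ xₙ ^ (2 * n)` from the unit ball of `ℓ²`. -/
theorem eventually_le_of_extension {F : lp (fun _ : ℕ => ℝ) ⊤ → ℝ}
    (hFf : ∀ x : lp (fun _ : ℕ => ℝ) 2, ‖x‖ < 1 →
      F (inclL2Linfty x) = ∑' n : ℕ, (x n) ^ (2 * (n + 1)))
    {n : ℕ} {t : ℝ} (ht : 0 < t) (ht1 : t < 1) (htN : 1 / 2 ≤ t ^ (2 * (n + 1)))
    {u : lp (fun _ : ℕ => ℝ) 2} {D : Finset ℕ} (hn : n ∈ D) (hu : ∀ k ∉ D, u k = 0)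
    (hun : u n = 2) :
    ∀ᶠ s : ℝ in 𝓝[>] 0, F (inclL2Linfty (lp.single 2 n t)) + s * (n + 1) ≤
      F (inclL2Linfty (lp.single 2 n t) +
        s • (inclL2Linfty u - inclL2Linfty (lp.single 2 n t))) := by
  set p : lp (fun _ : ℕ => ℝ) 2 := lp.single 2 n t with hp
  have hpn : ‖p‖ < 1 := by
    rw [hp, lp.norm_single (by norm_num), Real.norm_of_nonneg ht.le]
    exact ht1
  have hball : ∀ᶠ s : ℝ in 𝓝[>] 0, ‖p + s • (u - p)‖ < 1 := by
    have hc : Continuous fun s : ℝ => ‖p + s • (u - p)‖ := by fun_prop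
    have h : Tendsto (fun s : ℝ => ‖p + s • (u - p)‖) (𝓝 0) (𝓝 ‖p‖) := by
      simpa using hc.tendsto 0
    exact (h.mono_left nhdsWithin_le_nhds).eventually (Iio_mem_nhds hpn)
  filter_upwards [hball, self_mem_nhdsWithin] with s hs hs0
  rw [Set.mem_Ioi] at hs0
  have hincl : inclL2Linfty p + s • (inclL2Linfty u - inclL2Linfty p) =
      inclL2Linfty (p + s • (u - p)) := by
    ext k
    simp only [lp.coeFn_add, lp.coeFn_smul, lp.coeFn_sub, inclL2Linfty_apply, Pi.add_apply,
      Pi.smul_apply, Pi.sub_apply]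
  rw [hincl, hFf _ hs, hFf _ hpn, tsum_pow_even_single]
  have hcoord (k : ℕ) : (p + s • (u - p)) k = p k + s * (u k - p k) := by
    rw [lp.coeFn_add, lp.coeFn_smul, lp.coeFn_sub, Pi.add_apply, Pi.smul_apply, Pi.sub_apply,
      smul_eq_mul]
  have hzero : ∀ k ∉ D, (p + s • (u - p)) k = 0 := fun k hk => by
    have hpk : p k = 0 := lp.single_apply_ne _ _ _ (ne_of_mem_of_not_mem hn hk).symm
    rw [hcoord, hu k hk, hpk]
    simp
  refine le_trans ?_ (pow_even_le_tsum hzero n)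
  have hpt : p n = t := lp.single_apply_self _ _ _
  rw [hcoord, hun, hpt]
  refine le_trans ?_ (pow_add_mul_pow_mul_le_add_pow ht ht1.le
    (mul_nonneg hs0.le (by linarith)) (2 * (n + 1)))
  have h1 : s ≤ s * (2 - t) := le_mul_of_one_le_right hs0.le (by linarith)
  have h2 : (n : ℝ) + 1 ≤ ((2 * (n + 1) : ℕ) : ℝ) * t ^ (2 * (n + 1)) := by
    push_cast
    nlinarith [(Nat.cast_nonneg n : (0 : ℝ) ≤ n)]
  have h3 := mul_le_mul h2 h1 hs0.le (le_trans (by positivity) h2)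
  linarith

/-- Twice the indicator of a set of natural numbers, as a bounded sequence. -/
noncomputable def twiceIndicator (A : Set ℕ) : lp (fun _ : ℕ => ℝ) ⊤ :=
  ⟨A.indicator fun _ => 2, memℓp_infty ⟨2, by
    rintro _ ⟨k, rfl⟩
    refine (norm_indicator_le_norm_self _ _).trans ?_
    norm_num⟩⟩

theorem twiceIndicator_apply (A : Set ℕ) (k : ℕ) :
    twiceIndicator A k = A.indicator (fun _ => (2 : ℝ)) k := rfl

/-- The truncation of a sequence to a finite set of indices, in `ℓ²`. -/
noncomputable def finsetTruncation (D : Finset ℕ) (a : ℕ → ℝ) : lp (fun _ : ℕ => ℝ) 2 :=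
  ∑ i ∈ D, lp.single 2 i (a i)

theorem finsetTruncation_apply (D : Finset ℕ) (a : ℕ → ℝ) (k : ℕ) :
    finsetTruncation D a k = if k ∈ D then a k else 0 := by
  rw [finsetTruncation, lp.coeFn_sum, Finset.sum_apply]
  simp [Pi.single_apply]

/-- Outside a finite set, a finite sum of indicators of almost disjoint sets is bounded by one of
them. -/
theorem exists_finset_sum_twiceIndicator_le {ι : Type*} {A : ι → Set ℕ}
    (hA : Pairwise fun i j => (A i ∩ A j).Finite) (J : Finset ι) (n : ℕ) :
    ∃ D : Finset ℕ, n ∈ D ∧ ∀ k ∉ D, ∑ i ∈ J, twiceIndicator (A i) k ≤ 2 := by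
  classical
  have hfin : (⋃ q ∈ J.offDiag, A q.1 ∩ A q.2).Finite :=
    J.offDiag.finite_toSet.biUnion fun q hq => hA (Finset.mem_offDiag.1 hq).2.2
  refine ⟨insert n hfin.toFinset, Finset.mem_insert_self _ _, fun k hk => ?_⟩
  simp only [Finset.mem_insert, Set.Finite.mem_toFinset, Set.mem_iUnion, not_or, not_exists] at hk
  by_cases h : ∃ i ∈ J, k ∈ A i
  · obtain ⟨i, hi, hki⟩ := h
    rw [Finset.sum_eq_single_of_mem i hi]
    · rw [twiceIndicator_apply, Set.indicator_of_mem hki]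
    · intro j hj hji
      rw [twiceIndicator_apply, Set.indicator_of_notMem]
      exact fun hkj => hk.2 (j, i) (Finset.mem_offDiag.2 ⟨hj, hi, hji⟩) ⟨hkj, hki⟩
  · push Not at h
    rw [Finset.sum_eq_zero fun i hi => by
      rw [twiceIndicator_apply, Set.indicator_of_notMem (h i hi)]]
    norm_num

/-- For each `n`, only finitely many members of an almost disjoint family that contain `n` have an
indicator at which the extension is small. -/
theorem finite_setOf_extension_lt {F : lp (fun _ : ℕ => ℝ) ⊤ → ℝ} (hF : Continuous F)
    (hconv : ConvexOn ℝ Set.univ F)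
    (hFf : ∀ x : lp (fun _ : ℕ => ℝ) 2, ‖x‖ < 1 →
      F (inclL2Linfty x) = ∑' n : ℕ, (x n) ^ (2 * (n + 1)))
    {ι : Type*} {A : ι → Set ℕ} (hA : Pairwise fun i j => (A i ∩ A j).Finite) (n : ℕ) :
    {i | n ∈ A i ∧ F (twiceIndicator (A i)) < n}.Finite := by
  by_contra hinf
  obtain ⟨t, ht, ht1, htN⟩ : ∃ t : ℝ, 0 < t ∧ t < 1 ∧ 1 / 2 ≤ t ^ (2 * (n + 1)) := by
    have hlim : Tendsto (fun t : ℝ => t ^ (2 * (n + 1))) (𝓝[<] 1) (𝓝 1) := by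
      have hc : Continuous fun t : ℝ => t ^ (2 * (n + 1)) := by fun_prop
      simpa using (hc.tendsto 1).mono_left nhdsWithin_le_nhds
    have hpos : ∀ᶠ t : ℝ in 𝓝[<] 1, 0 < t := nhdsWithin_le_nhds (Ioi_mem_nhds zero_lt_one)
    obtain ⟨t, ht, ht1, htN⟩ := (hpos.and (eventually_mem_nhdsWithin.and
      (hlim.eventually (Ici_mem_nhds (by norm_num : (1 / 2 : ℝ) < 1))))).exists
    exact ⟨t, ht, ht1, htN⟩
  obtain ⟨L, hL0, hL⟩ :=
    ConvexOn.exists_le_add_mul_norm_sub hF hconv (inclL2Linfty (lp.single 2 n t))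
  obtain ⟨m, hm⟩ := exists_nat_gt (2 * L)
  have hm0 : (0 : ℝ) < m := lt_of_le_of_lt (by positivity) hm
  obtain ⟨J, hJ, hJm⟩ := Set.Infinite.exists_subset_card_eq hinf m
  obtain ⟨D, hnD, hD⟩ := exists_finset_sum_twiceIndicator_le hA J n
  set a : lp (fun _ : ℕ => ℝ) ⊤ := ∑ i ∈ J, (m : ℝ)⁻¹ • twiceIndicator (A i) with ha
  have haa (k : ℕ) : a k = (m : ℝ)⁻¹ * ∑ i ∈ J, twiceIndicator (A i) k := by
    rw [ha, lp.coeFn_sum, Finset.sum_apply, Finset.mul_sum]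
    rfl
  have han : a n = 2 := by
    rw [haa, Finset.sum_congr rfl fun i hi => by
      rw [twiceIndicator_apply, Set.indicator_of_mem (hJ hi).1], Finset.sum_const, hJm,
      nsmul_eq_mul]
    field_simp
  have hFa : F a ≤ n := by
    refine (hconv.map_sum_le (fun _ _ => by positivity) ?_ fun _ _ => Set.mem_univ _).trans ?_
    · rw [Finset.sum_const, hJm, nsmul_eq_mul, mul_inv_cancel₀ hm0.ne']
    · calc ∑ i ∈ J, (m : ℝ)⁻¹ • F (twiceIndicator (A i)) ≤ ∑ _i ∈ J, (m : ℝ)⁻¹ * n :=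
            Finset.sum_le_sum fun i hi => by
              rw [smul_eq_mul]
              exact mul_le_mul_of_nonneg_left (hJ hi).2.le (by positivity)
        _ = n := by
            rw [Finset.sum_const, hJm, nsmul_eq_mul]
            field_simp
  have hau : ‖a - inclL2Linfty (finsetTruncation D a)‖ ≤ (m : ℝ)⁻¹ * 2 := by
    refine lp.norm_le_of_forall_le (by positivity) fun k => ?_
    have hk : (a - inclL2Linfty (finsetTruncation D a)) k = a k - finsetTruncation D a k := by
      rw [lp.coeFn_sub, Pi.sub_apply, inclL2Linfty_apply]
    rw [hk, finsetTruncation_apply]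
    split_ifs with hkD
    · rw [sub_self, norm_zero]
      positivity
    · have hnonneg : 0 ≤ ∑ i ∈ J, twiceIndicator (A i) k :=
        Finset.sum_nonneg fun i _ => Set.indicator_nonneg (fun _ _ => zero_le_two) k
      rw [sub_zero, haa, Real.norm_of_nonneg (by positivity)]
      exact mul_le_mul_of_nonneg_left (hD k hkD) (by positivity)
  have hmain := hL a _ _ (eventually_le_of_extension hFf ht ht1 htN (u := finsetTruncation D a) hnD
    (fun k hk => by rw [finsetTruncation_apply, if_neg hk])
    (by rw [finsetTruncation_apply, if_pos hnD, han]))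
  have hp0 : 0 ≤ F (inclL2Linfty (lp.single 2 n t)) := by
    rw [hFf, tsum_pow_even_single]
    · positivity
    · rw [lp.norm_single (by norm_num), Real.norm_of_nonneg ht.le]
      exact ht1
  have hsmall : L * ((m : ℝ)⁻¹ * 2) < 1 := by
    rw [show L * ((m : ℝ)⁻¹ * 2) = 2 * L / m by ring, div_lt_one hm0]
    exact hm
  linarith [mul_le_mul_of_nonneg_left hau hL0]

/-- The codes of the finite prefixes of a binary sequence. -/
def prefixCodes (x : ℕ → Bool) : Set ℕ :=
  Set.range fun k : ℕ => Encodable.encode ((List.range k).map x)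

theorem injective_encode_map_range (x : ℕ → Bool) :
    Function.Injective fun k : ℕ => Encodable.encode ((List.range k).map x) := fun k l h => by
  simpa using congrArg List.length (Encodable.encode_injective h)

theorem infinite_prefixCodes (x : ℕ → Bool) : (prefixCodes x).Infinite :=
  Set.infinite_range_of_injective (injective_encode_map_range x)

theorem pairwise_finite_inter_prefixCodes :
    Pairwise fun x y => (prefixCodes x ∩ prefixCodes y).Finite := by
  intro x y hxy
  obtain ⟨j, hj⟩ := Function.ne_iff.1 hxy
  refine ((Set.finite_Iic j).image
    fun k : ℕ => Encodable.encode ((List.range k).map x)).subset ?_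
  rintro _ ⟨⟨k, rfl⟩, ⟨l, hl⟩⟩
  refine ⟨k, ?_, rfl⟩
  have hl' : (List.range l).map y = (List.range k).map x := Encodable.encode_injective hl
  obtain rfl : l = k := by simpa using congrArg List.length hl'
  by_contra hlt
  exact hj (List.map_inj_left.1 hl' j (List.mem_range.2 (not_le.1 hlt))).symm

/-- There is no continuous convex function `F : ℓ^∞ → ℝ` agreeing with
`f(x) = Σ_{n≥1} x_n^{2n}` on the open unit ball of `ℓ²`. -/
theorem no_continuous_convex_extension_to_linfty :
    ¬ ∃ F : lp (fun _ : ℕ => ℝ) ⊤ → ℝ, Continuous F ∧ ConvexOn ℝ Set.univ F ∧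
      ∀ x : lp (fun _ : ℕ => ℝ) 2, ‖x‖ < 1 →
        F (inclL2Linfty x) = ∑' n : ℕ, (x n) ^ (2 * (n + 1)) := by
  rintro ⟨F, hF, hconv, hFf⟩
  have hcount : (⋃ n : ℕ, {x | n ∈ prefixCodes x ∧
      F (twiceIndicator (prefixCodes x)) < n}).Countable :=
    Set.countable_iUnion fun n =>
      (finite_setOf_extension_lt hF hconv hFf pairwise_finite_inter_prefixCodes n).countable
  have huncount : ¬ (Set.univ : Set (ℕ → Bool)).Countable := by
    rw [Set.countable_univ_iff, ← Cardinal.mk_le_aleph0_iff, not_le]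
    simpa using Cardinal.cantor Cardinal.aleph0
  obtain ⟨x, hx⟩ := (Set.ne_univ_iff_exists_notMem _).1 fun h => huncount (h ▸ hcount)
  obtain ⟨N, hN⟩ := exists_nat_gt (F (twiceIndicator (prefixCodes x)))
  obtain ⟨n, hn, hNn⟩ := (infinite_prefixCodes x).exists_gt N
  refine hx (Set.mem_iUnion.2 ⟨n, hn, hN.trans ?_⟩)
  exact_mod_cast hNn
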